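/- arXiv:2209.00715 — 2 statements merged into one kernel-verified Lean document; each statement's English description precedes it below -/
import Mathlib

section
/- For each q ∈ B, if q̂ is a maximal element of M(q), then q̂ ∈ B, q̂ ≤ q, and α(q) ≤ 2ψ(q̂) ≤ 2α(q). -/
/-- In a (Dedekind complete) Riesz space `E`, the band projection of `x` onto the
band generated by `u`, given by `P_u x = sup_n (x⁺ ⊓ n|u|) - sup_n (x⁻ ⊓ n|u|)`.
For a component `p` of a weak order unit this is the product `p x`. -/
noncomputable def bandProj {E : Type*} [AddCommGroup E] [ConditionallyCompleteLattice E]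
    [CovariantClass E E (· + ·) (· ≤ ·)] (u x : E) : E :=
  sSup (Set.range fun n : ℕ => (x ⊔ 0) ⊓ n • |u|) -
    sSup (Set.range fun n : ℕ => ((-x) ⊔ 0) ⊓ n • |u|)

/-- `p` is a component of the weak order unit `e`: `0 ≤ p ≤ e` and `p ∧ (e - p) = 0`. -/
def IsComponent {E : Type*} [AddCommGroup E] [Lattice E] (e p : E) : Prop :=
  0 ≤ p ∧ p ≤ e ∧ p ⊓ (e - p) = 0

/-- The setting of the abstract Hahn-Jordan decomposition: a Dedekind complete Riesz
space `E` with weak order unit `e`, a Dedekind complete Riesz subspace `G` of `E`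
containing `e`, an order closed Boolean subalgebra `B` of the components of `e`
containing all components of `e` lying in `G`, and a map `ψ : B → G` which is
`K_G(e)`-homogeneous, additive on disjoint components, order continuous and order
bounded. -/
structure HJSetup (E : Type*) [AddCommGroup E] [ConditionallyCompleteLattice E]
    [CovariantClass E E (· + ·) (· ≤ ·)] [Module ℝ E] [PosSMulMono ℝ E] where
  /-- the weak order unit -/
  e : E
  /-- the Dedekind complete Riesz subspace `G` -/
  G : Set E
  /-- the Boolean algebra `B` of components of `e` -/
  B : Set E
  /-- the map `ψ : B → G` (values outside `B` are irrelevant) -/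
  ψ : E → E
  e_pos : 0 < e
  e_weak : ∀ x : E, 0 ≤ x → x ⊓ e = 0 → x = 0
  G_zero : (0 : E) ∈ G
  G_add : ∀ x ∈ G, ∀ y ∈ G, x + y ∈ G
  G_neg : ∀ x ∈ G, -x ∈ G
  G_smul : ∀ (c : ℝ), ∀ x ∈ G, c • x ∈ G
  G_sup : ∀ x ∈ G, ∀ y ∈ G, x ⊔ y ∈ G
  G_inf : ∀ x ∈ G, ∀ y ∈ G, x ⊓ y ∈ G
  /-- `G` is Dedekind complete (order closed in `E`) -/
  G_ded : ∀ S ⊆ G, S.Nonempty → BddAbove S → sSup S ∈ G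
  e_mem : e ∈ G
  B_comp : ∀ p ∈ B, IsComponent e p
  B_zero : (0 : E) ∈ B
  B_top : e ∈ B
  B_sup : ∀ p ∈ B, ∀ q ∈ B, p ⊔ q ∈ B
  B_inf : ∀ p ∈ B, ∀ q ∈ B, p ⊓ q ∈ B
  B_compl : ∀ p ∈ B, e - p ∈ B
  /-- `K_G(e) ⊆ B` -/
  KG_sub : ∀ p, IsComponent e p → p ∈ G → p ∈ B
  /-- `B` is order closed in `E`: if a (downward directed) net in `B` decreases to `p`
  in `E`, then `p ∈ B` -/
  B_orderClosed : ∀ S ⊆ B, S.Nonempty → DirectedOn (· ≥ ·) S → sInf S ∈ B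
  ψ_mem : ∀ p ∈ B, ψ p ∈ G
  /-- (i) `ψ(pq) = q ψ(p)` for `p ∈ B`, `q ∈ K_G(e)` -/
  ψ_mul : ∀ p ∈ B, ∀ q, IsComponent e q → q ∈ G → ψ (p ⊓ q) = bandProj q (ψ p)
  /-- (ii) additivity on disjoint components -/
  ψ_add : ∀ p ∈ B, ∀ q ∈ B, p ⊓ q = 0 → ψ (p ⊔ q) = ψ p + ψ q
  /-- (iii) order continuity: if a net `(p_α)` in `B` decreases to `p` in `E`, then
  `ψ(p_α) → ψ(p)` in order -/
  ψ_ordCont : ∀ S ⊆ B, S.Nonempty → DirectedOn (· ≥ ·) S →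
    ∃ w : E → E, (∀ p ∈ S, ∀ q ∈ S, p ≤ q → w p ≤ w q) ∧
      sInf (w '' S) = 0 ∧ ∀ p ∈ S, |ψ p - ψ (sInf S)| ≤ w p
  /-- (iv) `ψ` is order bounded -/
  ψ_bdd : ∃ g : E, 0 ≤ g ∧ ∀ p ∈ B, |ψ p| ≤ g

namespace HJSetup

variable {E : Type*} [AddCommGroup E] [ConditionallyCompleteLattice E]
  [CovariantClass E E (· + ·) (· ≤ ·)] [Module ℝ E] [PosSMulMono ℝ E]

/-- `C(q) = {ψ(p) : p ∈ B, p ≤ q}`. -/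
def C (s : HJSetup E) (q : E) : Set E := {y | ∃ p ∈ s.B, p ≤ q ∧ y = s.ψ p}

/-- `α(q) = sup C(q)`. -/
noncomputable def alpha (s : HJSetup E) (q : E) : E := sSup (s.C q)

/-- `M(q) = {p ∈ B : p ≤ q, 2ψ(p) ≥ p α(q)}`. -/
def M (s : HJSetup E) (q : E) : Set E :=
  {p | p ∈ s.B ∧ p ≤ q ∧ bandProj p (s.alpha q) ≤ s.ψ p + s.ψ p}

/-- `q` is strongly positive with respect to `ψ`. -/
def StronglyPos (s : HJSetup E) (q : E) : Prop := ∀ p ∈ s.B, p ≤ q → 0 ≤ s.ψ p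

/-- `q` is strongly negative with respect to `ψ`. -/
def StronglyNeg (s : HJSetup E) (q : E) : Prop := ∀ p ∈ s.B, p ≤ q → s.ψ p ≤ 0

/-- `H = {p ∈ B : p strongly negative w.r.t. ψ}`. -/
def H (s : HJSetup E) : Set E := {p | p ∈ s.B ∧ s.StronglyNeg p}

end HJSetup

section DisjointComplement

/-- The disjoint complement of a set in a lattice ordered group. -/
def disjCompl {E : Type*} [AddCommGroup E] [Lattice E] [AddLeftMono E] (S : Set E) :
    AddSubgroup E where
  carrier := {x | ∀ y ∈ S, |x| ⊓ |y| = 0}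
  zero_mem' := fun y _ => by simp
  neg_mem' := fun {x} hx y hy => by simpa using hx y hy
  add_mem' := fun {a b} ha hb y hy => by
    apply le_antisymm _ (le_inf (abs_nonneg _) (abs_nonneg _))
    have h : (|a| + |b|) ⊓ |y| ≤ |a| ⊓ |y| + |b| ⊓ |y| := by
      rw [add_inf, inf_add, inf_add]
      refine le_inf (le_inf inf_le_left ?_) (le_inf ?_ ?_)
      · exact inf_le_right.trans (le_add_of_nonneg_right (abs_nonneg _))
      · exact inf_le_right.trans (le_add_of_nonneg_left (abs_nonneg _))
      · exact inf_le_right.trans (le_add_of_nonneg_right (abs_nonneg _))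
    rw [ha y hy, hb y hy, add_zero] at h
    exact (inf_le_inf_right _ (abs_add_le a b)).trans h

variable {E : Type*} [AddCommGroup E]

section Lattice

variable [Lattice E] [AddLeftMono E]

lemma mem_disjCompl {S : Set E} {x : E} : x ∈ disjCompl S ↔ ∀ y ∈ S, |x| ⊓ |y| = 0 := Iff.rfl

lemma mem_disjCompl_singleton {u x : E} : x ∈ disjCompl {u} ↔ |x| ⊓ |u| = 0 := by
  simp [mem_disjCompl]

lemma disjCompl_solid {S : Set E} {x y : E} (hy : y ∈ disjCompl S) (h : |x| ≤ |y|) :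
    x ∈ disjCompl S := fun z hz =>
  le_antisymm ((inf_le_inf_right _ h).trans (hy z hz).le) (le_inf (abs_nonneg _) (abs_nonneg _))

lemma mem_disjCompl_of_nonneg {S : Set E} {x y : E} (hy : y ∈ disjCompl S) (h0 : 0 ≤ x)
    (h : x ≤ y) : x ∈ disjCompl S :=
  disjCompl_solid hy (by rwa [abs_of_nonneg h0, abs_of_nonneg (h0.trans h)])

lemma sup_zero_mem_disjCompl {S : Set E} {x : E} (hx : x ∈ disjCompl S) :
    x ⊔ 0 ∈ disjCompl S :=
  disjCompl_solid hx (by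
    rw [abs_of_nonneg le_sup_right]
    exact sup_le (le_abs_self x) (abs_nonneg x))

lemma disjCompl_singleton_comm {u x : E} : x ∈ disjCompl {u} ↔ u ∈ disjCompl {x} := by
  rw [mem_disjCompl_singleton, mem_disjCompl_singleton, inf_comm]

lemma disjCompl_singleton_anti {u v : E} (hu : 0 ≤ u) (h : u ≤ v) {x : E}
    (hx : x ∈ disjCompl {v}) : x ∈ disjCompl {u} :=
  disjCompl_singleton_comm.2 (mem_disjCompl_of_nonneg (disjCompl_singleton_comm.1 hx) hu h)

lemma eq_zero_of_abs_inf_abs_self {x : E} (h : |x| ⊓ |x| = 0) : x = 0 := by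
  rw [inf_idem] at h
  exact le_antisymm (h ▸ le_abs_self x) (neg_nonpos.1 (h ▸ neg_le_abs x))

lemma eq_zero_of_mem_disjCompl_self {x : E} (h : x ∈ disjCompl {x}) : x = 0 :=
  eq_zero_of_abs_inf_abs_self (mem_disjCompl_singleton.1 h)

lemma eq_zero_of_mem_disjCompl {S : Set E} {x : E} (h : x ∈ disjCompl S)
    (h' : x ∈ disjCompl (disjCompl S : Set E)) : x = 0 :=
  eq_zero_of_abs_inf_abs_self (h' x h)

/-- The positive and the negative part of an element are disjoint. -/
lemma sup_zero_mem_disjCompl_neg (x : E) : (-x) ⊔ 0 ∈ disjCompl {x ⊔ 0} := by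
  rw [mem_disjCompl_singleton, abs_of_nonneg le_sup_right, abs_of_nonneg le_sup_right, inf_comm]
  exact posPart_inf_negPart_eq_zero x

lemma sup_zero_sub_sup_zero (x : E) : x ⊔ 0 - (-x) ⊔ 0 = x :=
  posPart_sub_negPart x

end Lattice

section BandProj

variable [ConditionallyCompleteLattice E]

lemma bddAbove_range_inf (u x : E) : BddAbove (Set.range fun n : ℕ => x ⊓ n • |u|) :=
  ⟨x, by rintro _ ⟨n, rfl⟩; exact inf_le_left⟩

lemma sSup_range_inf_le (u x : E) : sSup (Set.range fun n : ℕ => x ⊓ n • |u|) ≤ x :=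
  csSup_le (Set.range_nonempty _) (by rintro _ ⟨n, rfl⟩; exact inf_le_left)

lemma sSup_range_inf_nonneg (u : E) {x : E} (hx : 0 ≤ x) :
    0 ≤ sSup (Set.range fun n : ℕ => x ⊓ n • |u|) :=
  le_csSup (bddAbove_range_inf u x) ⟨0, by simpa using hx⟩

variable [AddLeftMono E]

lemma sSup_inf_eq_zero {S : Set E} (hS : S.Nonempty) (hb : BddAbove S) {w : E} (hw : 0 ≤ w)
    (h0 : ∀ s ∈ S, 0 ≤ s) (h : ∀ s ∈ S, s ⊓ w = 0) : sSup S ⊓ w = 0 := by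
  obtain ⟨t, ht⟩ := hS
  apply le_antisymm _ (le_inf ((h0 t ht).trans (le_csSup hb ht)) hw)
  have h1 : sSup S ≤ sSup S ⊔ w - w := by
    refine csSup_le ⟨t, ht⟩ fun s hs => ?_
    have h2 := inf_add_sup s w
    rw [h s hs, zero_add] at h2
    rw [le_sub_iff_add_le, ← h2]
    exact sup_le_sup_right (le_csSup hb hs) w
  rw [le_sub_iff_add_le, ← inf_add_sup] at h1
  simpa using h1

lemma sSup_range_inf_mem (u : E) {x : E} (hx : 0 ≤ x) :
    sSup (Set.range fun n : ℕ => x ⊓ n • |u|) ∈ disjCompl (disjCompl {u} : Set E) := by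
  intro z hz
  have hz' : |z| ⊓ |u| = 0 := mem_disjCompl_singleton.1 hz
  rw [abs_of_nonneg (sSup_range_inf_nonneg u hx)]
  have hn : ∀ n : ℕ, 0 ≤ n • |u| := fun n => nsmul_nonneg (abs_nonneg u) n
  refine sSup_inf_eq_zero (Set.range_nonempty _) (bddAbove_range_inf u x) (abs_nonneg z) ?_ ?_
  · rintro _ ⟨n, rfl⟩
    exact le_inf hx (hn n)
  · rintro _ ⟨n, rfl⟩
    have hmem : n • |u| ∈ disjCompl {z} :=
      nsmul_mem (disjCompl_solid (disjCompl_singleton_comm.1 hz) (abs_abs u).le) n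
    have := mem_disjCompl_singleton.1 (mem_disjCompl_of_nonneg hmem (le_inf hx (hn n)) inf_le_right)
    rwa [abs_of_nonneg (le_inf hx (hn n))] at this

lemma sub_sSup_range_inf_mem (u x : E) :
    x - sSup (Set.range fun n : ℕ => x ⊓ n • |u|) ∈ disjCompl {u} := by
  rw [mem_disjCompl_singleton]
  set y := sSup (Set.range fun n : ℕ => x ⊓ n • |u|)
  have hyx : 0 ≤ x - y := sub_nonneg.2 (sSup_range_inf_le u x)
  rw [abs_of_nonneg hyx]
  apply le_antisymm _ (le_inf hyx (abs_nonneg u))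
  have h : y ≤ y - (x - y) ⊓ |u| := by
    refine csSup_le (Set.range_nonempty _) ?_
    rintro _ ⟨n, rfl⟩
    rw [le_sub_iff_add_le]
    refine le_trans (le_inf ?_ ?_) (le_csSup (bddAbove_range_inf u x) ⟨n + 1, rfl⟩)
    · calc x ⊓ n • |u| + (x - y) ⊓ |u| ≤ y + (x - y) :=
            add_le_add (le_csSup (bddAbove_range_inf u x) ⟨n, rfl⟩) inf_le_left
        _ = x := by abel
    · rw [succ_nsmul]
      exact add_le_add inf_le_right inf_le_right
  simpa using h

lemma bandProj_of_nonneg (u : E) {x : E} (hx : 0 ≤ x) :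
    bandProj u x = sSup (Set.range fun n : ℕ => x ⊓ n • |u|) := by
  have h : ∀ n : ℕ, (0 : E) ⊓ n • |u| = 0 := fun n =>
    inf_eq_left.2 (nsmul_nonneg (abs_nonneg u) n)
  have hx' : -x ≤ 0 := neg_nonpos.2 hx
  simp [bandProj, sup_eq_left.2 hx, sup_eq_right.2 hx', h]

lemma bandProj_mem (u x : E) : bandProj u x ∈ disjCompl (disjCompl {u} : Set E) :=
  sub_mem (sSup_range_inf_mem u le_sup_right) (sSup_range_inf_mem u le_sup_right)

lemma sub_bandProj_mem (u x : E) : x - bandProj u x ∈ disjCompl {u} := by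
  have h := sub_mem (sub_sSup_range_inf_mem u (x ⊔ 0)) (sub_sSup_range_inf_mem u (-x ⊔ 0))
  rwa [sub_sub_sub_comm, sup_zero_sub_sup_zero] at h

lemma bandProj_nonneg (u : E) {x : E} (hx : 0 ≤ x) : 0 ≤ bandProj u x :=
  bandProj_of_nonneg u hx ▸ sSup_range_inf_nonneg u hx

lemma bandProj_le (u : E) {x : E} (hx : 0 ≤ x) : bandProj u x ≤ x :=
  bandProj_of_nonneg u hx ▸ sSup_range_inf_le u x

lemma bandProj_add (u x y : E) : bandProj u (x + y) = bandProj u x + bandProj u y := by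
  rw [← sub_eq_zero]
  refine eq_zero_of_mem_disjCompl (S := {u}) ?_
    (sub_mem (bandProj_mem u _) (add_mem (bandProj_mem u _) (bandProj_mem u _)))
  have h := sub_mem (add_mem (sub_bandProj_mem u x) (sub_bandProj_mem u y))
    (sub_bandProj_mem u (x + y))
  convert h using 1
  abel

lemma bandProj_sub (u x y : E) : bandProj u (x - y) = bandProj u x - bandProj u y := by
  rw [eq_sub_iff_add_eq, ← bandProj_add, sub_add_cancel]

lemma bandProj_mono (u : E) {x y : E} (h : x ≤ y) : bandProj u x ≤ bandProj u y := by
  rw [← sub_nonneg, ← bandProj_sub]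
  exact bandProj_nonneg u (sub_nonneg.2 h)

lemma bandProj_eq_zero {u x : E} : bandProj u x = 0 ↔ x ∈ disjCompl {u} := by
  constructor
  · intro h
    simpa [h] using sub_bandProj_mem u x
  · intro h
    refine eq_zero_of_mem_disjCompl (S := {u}) ?_ (bandProj_mem u x)
    simpa using sub_mem h (sub_bandProj_mem u x)

lemma bandProj_mono_left {u v x : E} (hu : 0 ≤ u) (h : u ≤ v) (hx : 0 ≤ x) :
    bandProj u x ≤ bandProj v x := by
  rw [bandProj_of_nonneg u hx, bandProj_of_nonneg v hx]
  refine csSup_le (Set.range_nonempty _) ?_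
  rintro _ ⟨n, rfl⟩
  refine le_trans (inf_le_inf_left _ ?_) (le_csSup (bddAbove_range_inf v x) ⟨n, rfl⟩)
  rw [abs_of_nonneg hu, abs_of_nonneg (hu.trans h)]
  exact nsmul_le_nsmul_right h n

lemma bandProj_add_left_le {u v x : E} (hu : 0 ≤ u) (hv : 0 ≤ v) (hx : 0 ≤ x) :
    bandProj (u + v) x ≤ bandProj u x + bandProj v x := by
  rw [bandProj_of_nonneg _ hx]
  refine csSup_le (Set.range_nonempty _) ?_
  rintro _ ⟨n, rfl⟩
  have h1 : x ⊓ n • |u| ≤ bandProj u x :=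
    bandProj_of_nonneg u hx ▸ le_csSup (bddAbove_range_inf u x) ⟨n, rfl⟩
  have h2 : x ⊓ n • |v| ≤ bandProj v x :=
    bandProj_of_nonneg v hx ▸ le_csSup (bddAbove_range_inf v x) ⟨n, rfl⟩
  refine le_trans ?_ (add_le_add h1 h2)
  simp only [abs_of_nonneg hu, abs_of_nonneg hv, abs_of_nonneg (add_nonneg hu hv), nsmul_add]
  rw [add_inf, inf_add, inf_add]
  have hu' := nsmul_nonneg hu n
  have hv' := nsmul_nonneg hv n
  refine le_inf (le_inf ?_ ?_) (le_inf ?_ inf_le_right)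
  · exact inf_le_left.trans (le_add_of_nonneg_right hx)
  · exact inf_le_left.trans (le_add_of_nonneg_left hu')
  · exact inf_le_left.trans (le_add_of_nonneg_right hv')

/-- If the positive part of `x` is disjoint from `u`, then the projection of `x` is nonpositive. -/
lemma bandProj_nonpos {u x : E} (h : x ⊔ 0 ∈ disjCompl {u}) : bandProj u x ≤ 0 :=
  (bandProj_mono u le_sup_left).trans (bandProj_eq_zero.2 h).le

end BandProj

end DisjointComplement

namespace HJSetup

variable {E : Type*} [AddCommGroup E] [ConditionallyCompleteLattice E]
  [CovariantClass E E (· + ·) (· ≤ ·)] [Module ℝ E] [PosSMulMono ℝ E] (s : HJSetup E)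

lemma bandProj_mem_G {u x : E} (hu : u ∈ s.G) (hx : x ∈ s.G) : bandProj u x ∈ s.G := by
  have key : ∀ y ∈ s.G, sSup (Set.range fun n : ℕ => y ⊓ n • |u|) ∈ s.G := by
    intro y hy
    refine s.G_ded _ ?_ (Set.range_nonempty _) (bddAbove_range_inf u y)
    rintro _ ⟨n, rfl⟩
    refine s.G_inf _ hy _ ?_
    rw [← Nat.cast_smul_eq_nsmul ℝ]
    exact s.G_smul _ _ (s.G_sup _ hu _ (s.G_neg _ hu))
  rw [bandProj, sub_eq_add_neg]
  exact s.G_add _ (key _ (s.G_sup _ hx _ s.G_zero)) _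
    (s.G_neg _ (key _ (s.G_sup _ (s.G_neg _ hx) _ s.G_zero)))

lemma isComponent_bandProj (u : E) : IsComponent s.e (bandProj u s.e) := by
  have h0 := bandProj_nonneg u s.e_pos.le
  have h1 := bandProj_le u s.e_pos.le
  refine ⟨h0, h1, ?_⟩
  have h := bandProj_mem u s.e _ (sub_bandProj_mem u s.e)
  rwa [abs_of_nonneg h0, abs_of_nonneg (sub_nonneg.2 h1)] at h

/-- The projection of the weak order unit on the band generated by `u` generates the same band
as `u`. -/
lemma mem_disjCompl_bandProj {u x : E} :
    x ∈ disjCompl {bandProj u s.e} ↔ x ∈ disjCompl {u} := by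
  constructor
  · intro hx
    rw [mem_disjCompl_singleton]
    have h0 : 0 ≤ |x| ⊓ |u| := le_inf (abs_nonneg _) (abs_nonneg _)
    refine s.e_weak _ h0 ?_
    have h1 : |x| ⊓ |u| ∈ disjCompl {bandProj u s.e} :=
      disjCompl_solid hx (by rw [abs_of_nonneg h0]; exact inf_le_left)
    have h2 : |x| ⊓ |u| ∈ disjCompl {s.e - bandProj u s.e} :=
      disjCompl_solid (disjCompl_singleton_comm.1 (sub_bandProj_mem u s.e))
        (by rw [abs_of_nonneg h0]; exact inf_le_right)
    have h3 := add_mem (disjCompl_singleton_comm.1 h1) (disjCompl_singleton_comm.1 h2)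
    rw [add_sub_cancel, mem_disjCompl_singleton, abs_of_nonneg h0, abs_of_nonneg s.e_pos.le] at h3
    rwa [inf_comm]
  · intro hx
    rw [disjCompl_singleton_comm, mem_disjCompl_singleton]
    exact bandProj_mem u s.e x hx

lemma psi_zero : s.ψ 0 = 0 := by
  simpa using s.ψ_add 0 s.B_zero 0 s.B_zero (by simp)

lemma B_nonneg {p : E} (hp : p ∈ s.B) : 0 ≤ p := (s.B_comp p hp).1

lemma zero_mem_C {q : E} (hq : q ∈ s.B) : (0 : E) ∈ s.C q :=
  ⟨0, s.B_zero, s.B_nonneg hq, s.psi_zero.symm⟩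

lemma bddAbove_C (q : E) : BddAbove (s.C q) := by
  obtain ⟨g, -, hg⟩ := s.ψ_bdd
  refine ⟨g, ?_⟩
  rintro _ ⟨p, hp, -, rfl⟩
  exact (le_abs_self _).trans (hg p hp)

lemma psi_le_alpha {p q : E} (hp : p ∈ s.B) (hpq : p ≤ q) : s.ψ p ≤ s.alpha q :=
  le_csSup (s.bddAbove_C q) ⟨p, hp, hpq, rfl⟩

lemma alpha_nonneg {q : E} (hq : q ∈ s.B) : 0 ≤ s.alpha q :=
  le_csSup (s.bddAbove_C q) (s.zero_mem_C hq)

lemma alpha_mem_G {q : E} (hq : q ∈ s.B) : s.alpha q ∈ s.G := by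
  refine s.G_ded _ ?_ ⟨0, s.zero_mem_C hq⟩ (s.bddAbove_C q)
  rintro _ ⟨p, hp, -, rfl⟩
  exact s.ψ_mem p hp

/-- Homogeneity of `ψ` with respect to the component generated by an element of `G`. -/
lemma psi_inf_bandProj {p u : E} (hp : p ∈ s.B) (hu : u ∈ s.G) :
    s.ψ (p ⊓ bandProj u s.e) = bandProj (bandProj u s.e) (s.ψ p) :=
  s.ψ_mul p hp _ (s.isComponent_bandProj u) (s.bandProj_mem_G hu s.e_mem)

/-- If `2ψ(p) ≤ α(q)` on the band generated by `h`, for every `p ∈ B` below `q`, then `α(q)`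
vanishes on that band. -/
lemma alpha_mem_disjCompl {q h : E} (hq : q ∈ s.B)
    (H : ∀ p ∈ s.B, p ≤ q → (s.ψ p + s.ψ p - s.alpha q) ⊔ 0 ∈ disjCompl {h}) :
    s.alpha q ∈ disjCompl {h} := by
  rw [← bandProj_eq_zero]
  set A := bandProj h (s.alpha q)
  have half : (2⁻¹ : ℝ) • A + (2⁻¹ : ℝ) • A = A := by
    rw [← add_smul]; norm_num
  have hle : s.alpha q ≤ s.alpha q - (2⁻¹ : ℝ) • A := by
    refine csSup_le ⟨0, s.zero_mem_C hq⟩ ?_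
    rintro _ ⟨p, hp, hpq, rfl⟩
    have ht : 0 ≤ s.alpha q - s.ψ p := sub_nonneg.2 (s.psi_le_alpha hp hpq)
    have h1 := bandProj_nonpos (H p hp hpq)
    have h2 : s.ψ p + s.ψ p - s.alpha q
        = s.alpha q - ((s.alpha q - s.ψ p) + (s.alpha q - s.ψ p)) := by abel
    rw [h2, bandProj_sub, bandProj_add, sub_nonpos] at h1
    have h3 : A ≤ (s.alpha q - s.ψ p) + (s.alpha q - s.ψ p) :=
      h1.trans (add_le_add (bandProj_le h ht) (bandProj_le h ht))
    have h4 := smul_le_smul_of_nonneg_left h3 (by norm_num : (0 : ℝ) ≤ 2⁻¹)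
    rw [smul_add, ← add_smul, show (2⁻¹ : ℝ) + 2⁻¹ = 1 by norm_num, one_smul] at h4
    exact le_sub_comm.1 h4
  have hneg : (2⁻¹ : ℝ) • A ≤ 0 := by simpa using hle
  refine le_antisymm ?_ (bandProj_nonneg h (s.alpha_nonneg hq))
  rw [← half]
  exact add_nonpos hneg hneg

/-- If `2ψ(p) ≥ α(q)` on the band generated by `k ∈ G`, and this band is disjoint from the
component `r ∈ M q`, then adding to `r` the part of `p` in this band gives an element of `M q`. -/
lemma sup_inf_bandProj_mem_M {q r p k : E} (hq : q ∈ s.B) (hr : r ∈ s.M q) (hp : p ∈ s.B)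
    (hpq : p ≤ q) (hk : k ∈ s.G) (hrk : r ∈ disjCompl {k})
    (hpk : (s.alpha q - (s.ψ p + s.ψ p)) ⊔ 0 ∈ disjCompl {k}) :
    r ⊓ (p ⊓ bandProj k s.e) = 0 ∧ r ⊔ (p ⊓ bandProj k s.e) ∈ s.M q := by
  obtain ⟨hrB, hrq, hr⟩ := hr
  have hc := s.isComponent_bandProj k
  set c := bandProj k s.e
  have hcB : c ∈ s.B := s.KG_sub c hc (s.bandProj_mem_G hk s.e_mem)
  have hpcB := s.B_inf p hp c hcB
  have hr0 := s.B_nonneg hrB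
  have hpc0 := s.B_nonneg hpcB
  have hdisj : r ⊓ (p ⊓ c) = 0 := by
    have h := mem_disjCompl_singleton.1
      (disjCompl_singleton_anti hpc0 inf_le_right (s.mem_disjCompl_bandProj.2 hrk))
    rwa [abs_of_nonneg hr0, abs_of_nonneg hpc0] at h
  refine ⟨hdisj, s.B_sup r hrB _ hpcB, sup_le hrq (inf_le_left.trans hpq), ?_⟩
  have hsum : r ⊔ p ⊓ c = r + p ⊓ c := by
    have h := inf_add_sup r (p ⊓ c)
    rwa [hdisj, zero_add] at h
  have hα := s.alpha_nonneg hq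
  have h1 : bandProj c (s.alpha q) ≤ bandProj c (s.ψ p) + bandProj c (s.ψ p) := by
    have h := bandProj_nonpos (s.mem_disjCompl_bandProj.2 hpk)
    rwa [bandProj_sub, bandProj_add, sub_nonpos] at h
  rw [s.ψ_add r hrB _ hpcB hdisj, hsum, s.psi_inf_bandProj hp hk, add_add_add_comm]
  exact (bandProj_add_left_le hr0 hpc0 hα).trans
    (add_le_add hr ((bandProj_mono_left hpc0 inf_le_right hα).trans h1))

end HJSetup

/-- For each `q ∈ B`, if `q̂` is a maximal element of `M(q)`, then
`q̂ ∈ B`, `q̂ ≤ q` and `α(q) ≤ 2ψ(q̂) ≤ 2α(q)`. -/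
theorem hj_lower {E : Type*} [AddCommGroup E]
    [ConditionallyCompleteLattice E] [CovariantClass E E (· + ·) (· ≤ ·)]
    [Module ℝ E] [PosSMulMono ℝ E] (s : HJSetup E) (q : E) (hq : q ∈ s.B)
    (qhat : E) (hqhat : qhat ∈ s.M q) (hmax : ∀ p ∈ s.M q, qhat ≤ p → p = qhat) :
    qhat ∈ s.B ∧ qhat ≤ q ∧ s.alpha q ≤ s.ψ qhat + s.ψ qhat ∧
      s.ψ qhat + s.ψ qhat ≤ s.alpha q + s.alpha q := by
  obtain ⟨hB, hle, hM⟩ := id hqhat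
  have hψ := s.psi_le_alpha hB hle
  refine ⟨hB, hle, ?_, add_le_add hψ hψ⟩
  have hα := s.alpha_mem_G hq
  have hψG := s.ψ_mem _ hB
  set d := s.alpha q - (s.ψ qhat + s.ψ qhat) with hd
  have hdG : d ∈ s.G := by
    rw [hd, sub_eq_add_neg]
    exact s.G_add _ hα _ (s.G_neg _ (s.G_add _ hψG _ hψG))
  have hhG : d ⊔ 0 ∈ s.G := s.G_sup _ hdG _ s.G_zero
  have hdisj : qhat ∈ disjCompl {d ⊔ 0} :=
    disjCompl_singleton_comm.1 (mem_disjCompl_of_nonneg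
      (sup_zero_mem_disjCompl (sub_bandProj_mem qhat (s.alpha q))) le_sup_right
      (sup_le_sup_right (sub_le_sub_left hM _) 0))
  have hψdisj : s.ψ qhat ∈ disjCompl {d ⊔ 0} := by
    have h0 := mem_disjCompl_singleton.1 (s.mem_disjCompl_bandProj.2 hdisj)
    rw [abs_of_nonneg (s.B_nonneg hB), abs_of_nonneg (s.isComponent_bandProj _).1] at h0
    have h1 := s.psi_inf_bandProj hB hhG
    rw [h0, s.psi_zero] at h1
    exact s.mem_disjCompl_bandProj.1 (bandProj_eq_zero.1 h1.symm)
  have hαdisj : s.alpha q ∈ disjCompl {d ⊔ 0} := by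
    refine s.alpha_mem_disjCompl hq fun p hp hpq => ?_
    have hpG := s.ψ_mem p hp
    set t := s.ψ p + s.ψ p - s.alpha q with ht
    have htG : t ∈ s.G := by
      rw [ht, sub_eq_add_neg]
      exact s.G_add _ (s.G_add _ hpG _ hpG) _ (s.G_neg _ hα)
    set k := (t ⊔ 0) ⊓ (d ⊔ 0)
    have hk0 : 0 ≤ k := le_inf le_sup_right le_sup_right
    have hkG : k ∈ s.G := s.G_inf _ (s.G_sup _ htG _ s.G_zero) _ hhG
    rw [mem_disjCompl_singleton, abs_of_nonneg le_sup_right, abs_of_nonneg le_sup_right]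
    have hneg : (-t) ⊔ 0 ∈ disjCompl {k} :=
      disjCompl_singleton_anti hk0 inf_le_left (sup_zero_mem_disjCompl_neg t)
    obtain ⟨hinf, hmem⟩ := s.sup_inf_bandProj_mem_M hq hqhat hp hpq hkG
      (disjCompl_singleton_anti hk0 inf_le_right hdisj) (by rwa [ht, neg_sub] at hneg)
    have hzero : p ⊓ bandProj k s.e = 0 := by
      rw [← hinf, eq_comm, inf_eq_right, ← sup_eq_left]
      exact hmax _ hmem le_sup_left
    have hψk : s.ψ p ∈ disjCompl {k} := by
      have h1 := s.psi_inf_bandProj hp hkG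
      rw [hzero, s.psi_zero] at h1
      exact s.mem_disjCompl_bandProj.1 (bandProj_eq_zero.1 h1.symm)
    -- On the band generated by `k` one has `t ≥ 0`, `ψ p = 0` and `α(q) ≥ 0`.
    have htk : t ⊔ 0 ∈ disjCompl {k} :=
      mem_disjCompl_of_nonneg (sup_zero_mem_disjCompl (add_mem hψk hψk)) le_sup_right
        (sup_le_sup_right (sub_le_self _ (s.alpha_nonneg hq)) 0)
    exact eq_zero_of_mem_disjCompl_self (mem_disjCompl_of_nonneg htk hk0 inf_le_left)
  have hh : d ⊔ 0 = 0 := eq_zero_of_mem_disjCompl_self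
    (sup_zero_mem_disjCompl (sub_mem hαdisj (add_mem hψdisj hψdisj)))
  exact sub_nonpos.1 (sup_eq_right.1 hh)
end

section
/- Let H = {p ∈ B : p is strongly negative with respect to ψ}. Then 0 ∈ H; H is closed under pairwise suprema (if p₁, p₂ ∈ H then p₁ ∨ p₂ ∈ H); H is order closed with respect to limits of upwards directed nets; and H has a unique maximal element. -/
namespace HJSetup

variable {E : Type*} [AddCommGroup E] [ConditionallyCompleteLattice E]
  [CovariantClass E E (· + ·) (· ≤ ·)] [Module ℝ E] [PosSMulMono ℝ E]

theorem ψ_zero (s : HJSetup E) : s.ψ 0 = 0 := by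
  have h := s.ψ_add 0 s.B_zero 0 s.B_zero (inf_idem 0)
  rw [sup_idem] at h
  exact left_eq_add.mp h

theorem inf_compl_le (s : HJSetup E) {p a b : E} (ha : a ∈ s.B) (hb : b ∈ s.B)
    (hp : p ≤ a ⊔ b) : p ⊓ (s.e - a) ≤ b := by
  let := AddCommGroup.toDistribLattice E
  obtain ⟨-, -, h0⟩ := s.B_comp a ha
  calc p ⊓ (s.e - a) ≤ (a ⊔ b) ⊓ (s.e - a) := inf_le_inf_right _ hp
    _ = a ⊓ (s.e - a) ⊔ b ⊓ (s.e - a) := inf_sup_right _ _ _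
    _ ≤ b := by
      rw [h0]
      exact sup_le (s.B_comp b hb).1 inf_le_left

theorem ψ_split (s : HJSetup E) {p a : E} (hp : p ∈ s.B) (ha : a ∈ s.B) :
    s.ψ p = s.ψ (p ⊓ a) + s.ψ (p ⊓ (s.e - a)) := by
  let := AddCommGroup.toDistribLattice E
  obtain ⟨-, -, h0⟩ := s.B_comp a ha
  have hsup : a ⊔ (s.e - a) = s.e := by
    have h := inf_add_sup a (s.e - a)
    rwa [h0, zero_add, add_sub_cancel] at h
  have hdisj : p ⊓ a ⊓ (p ⊓ (s.e - a)) = 0 := by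
    rw [← inf_inf_distrib_left, h0]
    exact inf_eq_right.mpr (s.B_comp p hp).1
  rw [← s.ψ_add _ (s.B_inf _ hp _ ha) _ (s.B_inf _ hp _ (s.B_compl _ ha)) hdisj,
    ← inf_sup_left, hsup, inf_eq_left.mpr (s.B_comp p hp).2.1]

theorem zero_mem_H (s : HJSetup E) : (0 : E) ∈ s.H := by
  refine ⟨s.B_zero, fun p hp hp0 => ?_⟩
  rw [le_antisymm hp0 (s.B_comp p hp).1, s.ψ_zero]

theorem sup_mem_H (s : HJSetup E) {a b : E} (ha : a ∈ s.H) (hb : b ∈ s.H) :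
    a ⊔ b ∈ s.H := by
  refine ⟨s.B_sup _ ha.1 _ hb.1, fun p hp hle => ?_⟩
  rw [s.ψ_split hp ha.1]
  exact add_nonpos (ha.2 _ (s.B_inf _ hp _ ha.1) inf_le_right)
    (hb.2 _ (s.B_inf _ hp _ (s.B_compl _ ha.1)) (s.inf_compl_le ha.1 hb.1 hle))

theorem bddAbove_of_subset_B (s : HJSetup E) {S : Set E} (hS : S ⊆ s.B) : BddAbove S :=
  ⟨s.e, fun p hp => (s.B_comp p (hS hp)).2.1⟩

theorem sSup_mem_B (s : HJSetup E) {S : Set E} (hS : S ⊆ s.B) (hne : S.Nonempty)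
    (hdir : DirectedOn (· ≤ ·) S) : sSup S ∈ s.B := by
  have hbdd := s.bddAbove_of_subset_B hS
  have hglb : IsGLB ((fun p => s.e - p) '' S) (s.e - sSup S) := by
    constructor
    · rintro _ ⟨p, hp, rfl⟩
      exact sub_le_sub_left (le_csSup hbdd hp) _
    · intro u hu
      rw [le_sub_comm]
      exact csSup_le hne fun p hp => le_sub_comm.mp (hu ⟨p, hp, rfl⟩)
  have hmem : sInf ((fun p => s.e - p) '' S) ∈ s.B := by
    refine s.B_orderClosed _ ?_ (hne.image _) ?_
    · rintro _ ⟨p, hp, rfl⟩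
      exact s.B_compl p (hS hp)
    · rintro _ ⟨p, hp, rfl⟩ _ ⟨q, hq, rfl⟩
      obtain ⟨r, hr, hpr, hqr⟩ := hdir p hp q hq
      exact ⟨_, ⟨r, hr, rfl⟩, sub_le_sub_left hpr _, sub_le_sub_left hqr _⟩
  rw [hglb.csInf_eq (hne.image _)] at hmem
  simpa using s.B_compl _ hmem

theorem sSup_mem_H (s : HJSetup E) {S : Set E} (hS : S ⊆ s.H) (hne : S.Nonempty)
    (hdir : DirectedOn (· ≤ ·) S) : sSup S ∈ s.H := by
  have hSB : S ⊆ s.B := fun p hp => (hS hp).1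
  have hq := s.sSup_mem_B hSB hne hdir
  refine ⟨hq, fun r hr hrq => ?_⟩
  set T := (fun p => r ⊓ (s.e - p)) '' S
  have hTne : T.Nonempty := hne.image _
  have hTB : T ⊆ s.B := by
    rintro _ ⟨p, hp, rfl⟩
    exact s.B_inf _ hr _ (s.B_compl _ (hSB hp))
  have hTdir : DirectedOn (· ≥ ·) T := by
    rintro _ ⟨p, hp, rfl⟩ _ ⟨q, hq, rfl⟩
    obtain ⟨t, ht, hpt, hqt⟩ := hdir p hp q hq
    exact ⟨_, ⟨t, ht, rfl⟩, inf_le_inf_left _ (sub_le_sub_left hpt _),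
      inf_le_inf_left _ (sub_le_sub_left hqt _)⟩
  have hglb : IsGLB T 0 := by
    refine ⟨fun t ht => (s.B_comp t (hTB ht)).1, fun u hu => ?_⟩
    rw [← (s.B_comp _ hq).2.2]
    have hu' : ∀ p ∈ S, u ≤ r ⊓ (s.e - p) := fun p hp => hu ⟨p, hp, rfl⟩
    refine le_inf ?_ ?_
    · obtain ⟨p, hp⟩ := hne
      exact (hu' p hp).trans (inf_le_left.trans hrq)
    · rw [le_sub_comm]
      exact csSup_le hne fun p hp => le_sub_comm.mp ((hu' p hp).trans inf_le_right)
  obtain ⟨w, -, hw0, hw⟩ := s.ψ_ordCont T hTB hTne hTdir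
  rw [hglb.csInf_eq hTne, s.ψ_zero] at hw
  rw [← hw0]
  refine le_csInf (hTne.image _) ?_
  rintro _ ⟨_, ⟨p, hp, rfl⟩, rfl⟩
  have hneg := (hS hp).2 _ (s.B_inf _ hr _ (hSB hp)) inf_le_right
  have hbound := hw _ ⟨p, hp, rfl⟩
  rw [sub_zero] at hbound
  calc s.ψ r = s.ψ (r ⊓ p) + s.ψ (r ⊓ (s.e - p)) := s.ψ_split hr (hSB hp)
    _ ≤ s.ψ (r ⊓ (s.e - p)) := add_le_of_nonpos_left hneg
    _ ≤ _ := (le_abs_self _).trans hbound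

end HJSetup

/-- For `H = {p ∈ B : p strongly negative w.r.t. ψ}`: `0 ∈ H`; `H` is
closed under pairwise suprema; `H` is order closed with respect to limits of upwards
directed nets; and `H` has a unique maximal element. -/
theorem hj_H_properties {E : Type*} [AddCommGroup E]
    [ConditionallyCompleteLattice E] [CovariantClass E E (· + ·) (· ≤ ·)]
    [Module ℝ E] [PosSMulMono ℝ E] (s : HJSetup E) :
    (0 : E) ∈ s.H ∧
    (∀ p₁ ∈ s.H, ∀ p₂ ∈ s.H, p₁ ⊔ p₂ ∈ s.H) ∧
    (∀ S ⊆ s.H, S.Nonempty → DirectedOn (· ≤ ·) S → sSup S ∈ s.H) ∧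
    (∃! m, m ∈ s.H ∧ ∀ p ∈ s.H, m ≤ p → p = m) := by
  have hmem : sSup s.H ∈ s.H :=
    s.sSup_mem_H subset_rfl ⟨0, s.zero_mem_H⟩ fun a ha b hb =>
      ⟨a ⊔ b, s.sup_mem_H ha hb, le_sup_left, le_sup_right⟩
  have hle : ∀ p ∈ s.H, p ≤ sSup s.H := fun p hp =>
    le_csSup (s.bddAbove_of_subset_B fun _ h => h.1) hp
  exact ⟨s.zero_mem_H, fun _ h₁ _ h₂ => s.sup_mem_H h₁ h₂,
    fun _ hS hne hdir => s.sSup_mem_H hS hne hdir,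
    sSup s.H, ⟨hmem, fun p hp h => le_antisymm (hle p hp) h⟩,
    fun m hm => (hm.2 _ hmem (hle m hm.1)).symm⟩
end
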